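/- Let V be the linear span in P of all basis elements other than 1. If U and W are any two basis elements of P neither of which is 1, then the commutator [U, W] = UW − WU lies in V; that is, when [U, W] is written as a linear combination of basis elements, the coefficient of 1 is zero, so V is a Lie subalgebra of P. -/

import Mathlib

noncomputable section

/-- Generators of the algebra `P`. -/
inductive PGen : Type
  | K : PGen
  | A : PGen
  | B : PGen
  | C : PGen

/- The defining relations of the algebra `P`, where `q = p ^ 2`:
`(1 - q)AB = 1 - qC`, `(1 - q)BA = 1 - C`, `AC = qCA`, `qBC = CB` (i.e. `BC = q⁻¹CB`),
`pAK = KA` (i.e. `AK = p⁻¹KA`), `BK = pKB`, `CK = KC`, `K²C = 1`. -/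
open FreeAlgebra in
inductive PRel (p : ℂ) : FreeAlgebra ℂ PGen → FreeAlgebra ℂ PGen → Prop
  | ab : PRel p ((1 - p ^ 2) • (ι ℂ PGen.A * ι ℂ PGen.B)) (1 - p ^ 2 • ι ℂ PGen.C)
  | ba : PRel p ((1 - p ^ 2) • (ι ℂ PGen.B * ι ℂ PGen.A)) (1 - ι ℂ PGen.C)
  | ac : PRel p (ι ℂ PGen.A * ι ℂ PGen.C) (p ^ 2 • (ι ℂ PGen.C * ι ℂ PGen.A))
  | bc : PRel p (p ^ 2 • (ι ℂ PGen.B * ι ℂ PGen.C)) (ι ℂ PGen.C * ι ℂ PGen.B)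
  | ak : PRel p (p • (ι ℂ PGen.A * ι ℂ PGen.K)) (ι ℂ PGen.K * ι ℂ PGen.A)
  | bk : PRel p (ι ℂ PGen.B * ι ℂ PGen.K) (p • (ι ℂ PGen.K * ι ℂ PGen.B))
  | ck : PRel p (ι ℂ PGen.C * ι ℂ PGen.K) (ι ℂ PGen.K * ι ℂ PGen.C)
  | k2c : PRel p (ι ℂ PGen.K * ι ℂ PGen.K * ι ℂ PGen.C) 1

/-- The unital associative `ℂ`-algebra `P`, presented by generators `K, A, B, C`
and the relations above. -/
abbrev PAlg (p : ℂ) := RingQuot (PRel p)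

/-- The generator `K` of `P`. -/
def pK (p : ℂ) : PAlg p := RingQuot.mkAlgHom ℂ (PRel p) (FreeAlgebra.ι ℂ PGen.K)

/-- The generator `A` of `P`. -/
def pA (p : ℂ) : PAlg p := RingQuot.mkAlgHom ℂ (PRel p) (FreeAlgebra.ι ℂ PGen.A)

/-- The generator `B` of `P`. -/
def pB (p : ℂ) : PAlg p := RingQuot.mkAlgHom ℂ (PRel p) (FreeAlgebra.ι ℂ PGen.B)

/-- The generator `C` of `P`. -/
def pC (p : ℂ) : PAlg p := RingQuot.mkAlgHom ℂ (PRel p) (FreeAlgebra.ι ℂ PGen.C)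

/-- The candidate basis element of `P` indexed by `(h, k, z) : ℕ × ℕ × ℤ`:
`K^h C^k A^(-z)` if `z < 0`, `K^h C^k B^z` if `z > 0`, and `K^h C^k` if `z = 0`
(so `(0, 0, 0)` encodes the identity `1`). -/
def pBasisElt (p : ℂ) (t : ℕ × ℕ × ℤ) : PAlg p :=
  pK p ^ t.1 * pC p ^ t.2.1 *
    (if t.2.2 < 0 then pA p ^ (-t.2.2).toNat else pB p ^ t.2.2.toNat)

/-- The span `V` of all basis elements of `P` other than the identity `1`. -/
def Vspan (p : ℂ) : Submodule ℂ (PAlg p) :=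
  Submodule.span ℂ
    (pBasisElt p '' {t : ℕ × ℕ × ℤ | (1 ≤ t.2.1 → t.1 ≤ 1) ∧ t ≠ (0, 0, 0)})

section SkewLaurent

variable {R : Type*} [Ring R] [Algebra ℂ R] {κ : Rˣ} {a α β : ℂ} {A B : R}

lemma pow_mul_of_skew_commute (hA : A * κ = a • ((κ : R) * A)) (l : ℕ) :
    A ^ l * κ = a ^ l • ((κ : R) * A ^ l) := by
  induction l with
  | zero => simp
  | succ l ih =>
    rw [pow_succ, mul_assoc, hA, mul_smul_comm, ← mul_assoc, ih, smul_mul_assoc, smul_smul,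
      mul_assoc, pow_succ, mul_comm]

lemma mul_zpow_of_skew_commute (ha : a ≠ 0) (hA : A * κ = a • ((κ : R) * A)) (n : ℤ) :
    A * ((κ ^ n : Rˣ) : R) = a ^ n • (((κ ^ n : Rˣ) : R) * A) := by
  have step (m : ℤ) : ((κ ^ (m + 1) : Rˣ) : R) = ((κ ^ m : Rˣ) : R) * κ := by
    rw [zpow_add_one, Units.val_mul]
  induction n using Int.induction_on with
  | zero => simp
  | succ m ih =>
    rw [step, ← mul_assoc, ih, smul_mul_assoc, mul_assoc, hA, mul_smul_comm, smul_smul,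
      ← mul_assoc, zpow_add_one₀ ha]
  | pred m ih =>
    have h := step (-(m : ℤ) - 1)
    rw [sub_add_cancel] at h
    rw [← Units.mul_left_inj κ, mul_assoc, ← h, ih, h, smul_mul_assoc, mul_assoc, mul_assoc, hA,
      mul_smul_comm, smul_smul, ← zpow_add_one₀ ha, sub_add_cancel]

lemma mul_zpow_mul_pow_self (ha : a ≠ 0) (hA : A * κ = a • ((κ : R) * A)) (n : ℤ) (l : ℕ) :
    A * (((κ ^ n : Rˣ) : R) * A ^ l) = a ^ n • (((κ ^ n : Rˣ) : R) * A ^ (l + 1)) := by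
  rw [← mul_assoc, mul_zpow_of_skew_commute ha hA, smul_mul_assoc, mul_assoc, ← pow_succ']

lemma mul_zpow_mul_pow_succ (ha : a ≠ 0) (hA : A * κ = a • ((κ : R) * A))
    (hAB : A * B = α • 1 + β • ((κ ^ (-2 : ℤ) : Rˣ) : R)) (n : ℤ) (l : ℕ) :
    A * (((κ ^ n : Rˣ) : R) * B ^ (l + 1)) =
      (a ^ n * α) • (((κ ^ n : Rˣ) : R) * B ^ l) +
        (a ^ n * β) • (((κ ^ (n - 2) : Rˣ) : R) * B ^ l) := by
  have h : ((κ ^ (n - 2) : Rˣ) : R) = ((κ ^ n : Rˣ) : R) * ((κ ^ (-2 : ℤ) : Rˣ) : R) := by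
    rw [← Units.val_mul, ← zpow_add, sub_eq_add_neg]
  rw [← mul_assoc, mul_zpow_of_skew_commute ha hA, smul_mul_assoc, mul_assoc, pow_succ',
    ← mul_assoc A, hAB, h]
  simp only [add_mul, mul_add, smul_mul_assoc, mul_smul_comm, one_mul, smul_add, smul_smul,
    mul_assoc]

lemma zpow_mul_pow_succ_mul (ha : a ≠ 0) (hB : B * κ = a⁻¹ • ((κ : R) * B))
    (hBA : B * A = α • 1 + (β * a ^ 2) • ((κ ^ (-2 : ℤ) : Rˣ) : R)) (n : ℤ) (l : ℕ) :
    ((κ ^ n : Rˣ) : R) * B ^ (l + 1) * A =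
      α • (((κ ^ n : Rˣ) : R) * B ^ l) +
        (β * a ^ (2 * l + 2)) • (((κ ^ (n - 2) : Rˣ) : R) * B ^ l) := by
  have h : ((κ ^ (n - 2) : Rˣ) : R) = ((κ ^ n : Rˣ) : R) * ((κ ^ (-2 : ℤ) : Rˣ) : R) := by
    rw [← Units.val_mul, ← zpow_add, sub_eq_add_neg]
  have hc : (a⁻¹ ^ l) ^ (-2 : ℤ) = a ^ (2 * l) := by
    rw [inv_pow, inv_zpow', neg_neg, mul_comm 2 l, pow_mul]
    rfl
  have hl := mul_zpow_of_skew_commute (pow_ne_zero l (inv_ne_zero ha))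
    (pow_mul_of_skew_commute hB l) (-2)
  rw [hc] at hl
  rw [pow_succ, mul_assoc, mul_assoc, hBA, mul_add, mul_smul_comm, mul_smul_comm, hl, mul_one, h]
  simp only [mul_add, mul_smul_comm, smul_smul, mul_assoc]
  congr 2
  ring

/-- If `V` contains all nontrivial monomials, then it contains the commutator of `A` with every
monomial. -/
lemma commutator_mem_of_monomial_mem (ha : a ≠ 0) (hA : A * κ = a • ((κ : R) * A))
    (hB : B * κ = a⁻¹ • ((κ : R) * B))
    (hAB : A * B = α • 1 + β • ((κ ^ (-2 : ℤ) : Rˣ) : R))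
    (hBA : B * A = α • 1 + (β * a ^ 2) • ((κ ^ (-2 : ℤ) : Rˣ) : R))
    {V : Submodule ℂ R}
    (hVA : ∀ (n : ℤ) (l : ℕ), (n, l) ≠ (0, 0) → ((κ ^ n : Rˣ) : R) * A ^ l ∈ V)
    (hVB : ∀ (n : ℤ) (l : ℕ), (n, l) ≠ (0, 0) → ((κ ^ n : Rˣ) : R) * B ^ l ∈ V)
    (n : ℤ) (l : ℕ) :
    A * (((κ ^ n : Rˣ) : R) * A ^ l) - ((κ ^ n : Rˣ) : R) * A ^ l * A ∈ V ∧
      A * (((κ ^ n : Rˣ) : R) * B ^ l) - ((κ ^ n : Rˣ) : R) * B ^ l * A ∈ V := by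
  have self_mem (l : ℕ) :
      A * (((κ ^ n : Rˣ) : R) * A ^ l) - ((κ ^ n : Rˣ) : R) * A ^ l * A ∈ V := by
    have h := hVA n (l + 1) (by simp)
    rw [mul_zpow_mul_pow_self ha hA, mul_assoc, ← pow_succ]
    exact V.sub_mem (V.smul_mem _ h) h
  refine ⟨self_mem l, ?_⟩
  cases l with
  | zero => simpa using self_mem 0
  | succ l =>
    rw [mul_zpow_mul_pow_succ ha hA hAB, zpow_mul_pow_succ_mul ha hB hBA, add_sub_add_comm,
      ← sub_smul, ← sub_smul]
    refine V.add_mem ?_ ?_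
    · by_cases h : (n, l) = (0, 0)
      · obtain ⟨rfl, rfl⟩ := Prod.mk.inj h
        simp
      · exact V.smul_mem _ (hVB n l h)
    · by_cases h : (n - 2, l) = (0, 0)
      · obtain ⟨hn, rfl⟩ := Prod.mk.inj h
        obtain rfl : n = 2 := by omega
        have : a ^ (2 : ℤ) * β - β * a ^ (2 * 0 + 2) = 0 := by
          rw [show a ^ (2 : ℤ) = a ^ 2 from rfl]
          ring
        rw [this, zero_smul]
        exact V.zero_mem
      · exact V.smul_mem _ (hVB (n - 2) l h)

/-- The elements all of whose commutators lie in `V` form a subalgebra. -/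
def commutatorSubalgebra (V : Submodule ℂ R) : Subalgebra ℂ R where
  carrier := {x | ∀ y, x * y - y * x ∈ V}
  mul_mem' {x y} hx hy z := by
    have h : x * y * z - z * (x * y) = (x * (y * z) - y * z * x) + (y * (z * x) - z * x * y) := by
      noncomm_ring
    rw [h]
    exact V.add_mem (hx _) (hy _)
  add_mem' {x y} hx hy z := by
    have h : (x + y) * z - z * (x + y) = (x * z - z * x) + (y * z - z * y) := by noncomm_ring
    rw [h]
    exact V.add_mem (hx z) (hy z)
  algebraMap_mem' r y := by
    rw [Algebra.commutes, sub_self]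
    exact V.zero_mem

/-- The elements whose left multiplication preserves `T` form a subalgebra. -/
def leftStabilizer (T : Submodule ℂ R) : Subalgebra ℂ R where
  carrier := {x | ∀ y ∈ T, x * y ∈ T}
  mul_mem' {x y} hx hy z hz := by
    rw [mul_assoc]
    exact hx _ (hy z hz)
  add_mem' {x y} hx hy z hz := by
    rw [add_mul]
    exact T.add_mem (hx z hz) (hy z hz)
  algebraMap_mem' r y hy := by
    rw [← Algebra.smul_def]
    exact T.smul_mem r hy

variable (κ A B) in
/-- The span of the monomials `κ ^ n * A ^ l` and `κ ^ n * B ^ l`. -/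
def monomialSpan : Submodule ℂ R :=
  Submodule.span ℂ (Set.range (fun x : ℤ × ℕ => ((κ ^ x.1 : Rˣ) : R) * A ^ x.2) ∪
    Set.range (fun x : ℤ × ℕ => ((κ ^ x.1 : Rˣ) : R) * B ^ x.2))

lemma monomial_left_mem (n : ℤ) (l : ℕ) : ((κ ^ n : Rˣ) : R) * A ^ l ∈ monomialSpan κ A B :=
  Submodule.subset_span (Or.inl ⟨(n, l), rfl⟩)

lemma monomial_right_mem (n : ℤ) (l : ℕ) : ((κ ^ n : Rˣ) : R) * B ^ l ∈ monomialSpan κ A B :=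
  Submodule.subset_span (Or.inr ⟨(n, l), rfl⟩)

lemma monomialSpan_comm : monomialSpan κ A B = monomialSpan κ B A := by
  rw [monomialSpan, Set.union_comm, monomialSpan]

lemma monomialSpan_le {T : Submodule ℂ R}
    (hTA : ∀ (n : ℤ) (l : ℕ), ((κ ^ n : Rˣ) : R) * A ^ l ∈ T)
    (hTB : ∀ (n : ℤ) (l : ℕ), ((κ ^ n : Rˣ) : R) * B ^ l ∈ T) : monomialSpan κ A B ≤ T := by
  rw [monomialSpan, Submodule.span_le]
  rintro _ (⟨x, rfl⟩ | ⟨x, rfl⟩)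
  exacts [hTA _ _, hTB _ _]

lemma zpow_mem_leftStabilizer (m : ℤ) :
    ((κ ^ m : Rˣ) : R) ∈ leftStabilizer (monomialSpan κ A B) := by
  suffices monomialSpan κ A B ≤
      (monomialSpan κ A B).comap (LinearMap.mulLeft ℂ ((κ ^ m : Rˣ) : R)) from
    fun y hy => this hy
  refine monomialSpan_le (fun n l => ?_) (fun n l => ?_) <;>
    rw [Submodule.mem_comap, LinearMap.mulLeft_apply, ← mul_assoc, ← Units.val_mul, ← zpow_add]
  exacts [monomial_left_mem _ _, monomial_right_mem _ _]

lemma mem_leftStabilizer (ha : a ≠ 0) (hA : A * κ = a • ((κ : R) * A))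
    (hAB : A * B = α • 1 + β • ((κ ^ (-2 : ℤ) : Rˣ) : R)) :
    A ∈ leftStabilizer (monomialSpan κ A B) := by
  have self_mem (n : ℤ) (l : ℕ) :
      A * (((κ ^ n : Rˣ) : R) * A ^ l) ∈ monomialSpan κ A B := by
    rw [mul_zpow_mul_pow_self ha hA]
    exact Submodule.smul_mem _ _ (monomial_left_mem _ _)
  suffices monomialSpan κ A B ≤ (monomialSpan κ A B).comap (LinearMap.mulLeft ℂ A) from
    fun y hy => this hy
  refine monomialSpan_le self_mem (fun n l => ?_)
  rw [Submodule.mem_comap, LinearMap.mulLeft_apply]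
  cases l with
  | zero => simpa using self_mem n 0
  | succ l =>
    rw [mul_zpow_mul_pow_succ ha hA hAB]
    exact Submodule.add_mem _ (Submodule.smul_mem _ _ (monomial_right_mem _ _))
      (Submodule.smul_mem _ _ (monomial_right_mem _ _))

lemma zpow_commutator_mem (ha : a ≠ 0) (hA : A * κ = a • ((κ : R) * A))
    {V : Submodule ℂ R}
    (hVA : ∀ (n : ℤ) (l : ℕ), (n, l) ≠ (0, 0) → ((κ ^ n : Rˣ) : R) * A ^ l ∈ V)
    (m n : ℤ) (l : ℕ) :
    ((κ ^ m : Rˣ) : R) * (((κ ^ n : Rˣ) : R) * A ^ l) -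
      ((κ ^ n : Rˣ) : R) * A ^ l * ((κ ^ m : Rˣ) : R) ∈ V := by
  have hl := mul_zpow_of_skew_commute (pow_ne_zero l ha) (pow_mul_of_skew_commute hA l) m
  rw [mul_assoc _ (A ^ l), hl, mul_smul_comm, ← mul_assoc, ← mul_assoc, ← Units.val_mul,
    ← Units.val_mul, ← zpow_add, ← zpow_add, add_comm m n]
  cases l with
  | zero => simp
  | succ l =>
    have h := hVA (n + m) (l + 1) (by simp)
    exact V.sub_mem h (V.smul_mem _ h)

/-- If the powers of `κ` together with `A` and `B` generate `R` and `V` contains all nontrivial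
monomials, then `V` contains all commutators. -/
lemma commutator_mem (ha : a ≠ 0) (hA : A * κ = a • ((κ : R) * A))
    (hB : B * κ = a⁻¹ • ((κ : R) * B))
    (hAB : A * B = α • 1 + β • ((κ ^ (-2 : ℤ) : Rˣ) : R))
    (hBA : B * A = α • 1 + (β * a ^ 2) • ((κ ^ (-2 : ℤ) : Rˣ) : R))
    (hgen : ∀ S : Subalgebra ℂ R, (∀ m : ℤ, ((κ ^ m : Rˣ) : R) ∈ S) → A ∈ S → B ∈ S → S = ⊤)
    {V : Submodule ℂ R}
    (hVA : ∀ (n : ℤ) (l : ℕ), (n, l) ≠ (0, 0) → ((κ ^ n : Rˣ) : R) * A ^ l ∈ V)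
    (hVB : ∀ (n : ℤ) (l : ℕ), (n, l) ≠ (0, 0) → ((κ ^ n : Rˣ) : R) * B ^ l ∈ V)
    (x y : R) : x * y - y * x ∈ V := by
  have ha' : a⁻¹ ≠ 0 := inv_ne_zero ha
  have hA' : A * κ = a⁻¹⁻¹ • ((κ : R) * A) := by rwa [inv_inv]
  have hAB' : A * B = α • 1 + (β * a ^ 2 * a⁻¹ ^ 2) • ((κ ^ (-2 : ℤ) : Rˣ) : R) := by
    rw [hAB]
    congr 2
    field_simp
  have hstab : leftStabilizer (monomialSpan κ A B) = ⊤ :=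
    hgen _ zpow_mem_leftStabilizer (mem_leftStabilizer ha hA hAB)
      (monomialSpan_comm (κ := κ) (A := B) ▸ mem_leftStabilizer ha' hB hBA)
  have hspan (z : R) : z ∈ monomialSpan κ A B := by
    have hz : z ∈ leftStabilizer (monomialSpan κ A B) := hstab ▸ Algebra.mem_top
    have h1 : (1 : R) ∈ monomialSpan κ A B := by
      simpa using monomial_left_mem (κ := κ) (A := A) (B := B) 0 0
    simpa using hz 1 h1
  have mem_of (g : R)
      (h₁ : ∀ (n : ℤ) (l : ℕ),
        g * (((κ ^ n : Rˣ) : R) * A ^ l) - ((κ ^ n : Rˣ) : R) * A ^ l * g ∈ V)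
      (h₂ : ∀ (n : ℤ) (l : ℕ),
        g * (((κ ^ n : Rˣ) : R) * B ^ l) - ((κ ^ n : Rˣ) : R) * B ^ l * g ∈ V) :
      g ∈ commutatorSubalgebra V := by
    have hle : monomialSpan κ A B ≤
        V.comap (LinearMap.mulLeft ℂ g - LinearMap.mulRight ℂ g) := monomialSpan_le h₁ h₂
    exact fun z => hle (hspan z)
  have htop : commutatorSubalgebra V = ⊤ :=
    hgen _
      (fun m => mem_of _ (zpow_commutator_mem ha hA hVA m) (zpow_commutator_mem ha' hB hVB m))
      (mem_of _ (fun n l => (commutator_mem_of_monomial_mem ha hA hB hAB hBA hVA hVB n l).1)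
        (fun n l => (commutator_mem_of_monomial_mem ha hA hB hAB hBA hVA hVB n l).2))
      (mem_of _ (fun n l => (commutator_mem_of_monomial_mem ha' hB hA' hBA hAB' hVB hVA n l).2)
        (fun n l => (commutator_mem_of_monomial_mem ha' hB hA' hBA hAB' hVB hVA n l).1))
  have hx : x ∈ commutatorSubalgebra V := htop ▸ Algebra.mem_top
  exact hx y

end SkewLaurent

section Presentation

variable (p : ℂ)

lemma pA_mul_pB : (1 - p ^ 2) • (pA p * pB p) = 1 - p ^ 2 • pC p := by
  simpa [pA, pB, pC] using RingQuot.mkAlgHom_rel ℂ (PRel.ab (p := p))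

lemma pB_mul_pA : (1 - p ^ 2) • (pB p * pA p) = 1 - pC p := by
  simpa [pA, pB, pC] using RingQuot.mkAlgHom_rel ℂ (PRel.ba (p := p))

lemma pA_mul_pK : p • (pA p * pK p) = pK p * pA p := by
  simpa [pA, pK] using RingQuot.mkAlgHom_rel ℂ (PRel.ak (p := p))

lemma pB_mul_pK : pB p * pK p = p • (pK p * pB p) := by
  simpa [pB, pK] using RingQuot.mkAlgHom_rel ℂ (PRel.bk (p := p))

lemma pC_mul_pK : pC p * pK p = pK p * pC p := by
  simpa [pC, pK] using RingQuot.mkAlgHom_rel ℂ (PRel.ck (p := p))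

lemma pK_mul_pK_mul_pC : pK p * pK p * pC p = 1 := by
  simpa [pC, pK] using RingQuot.mkAlgHom_rel ℂ (PRel.k2c (p := p))

/-- The generator `K` as a unit, with inverse `KC`. -/
def pKUnit : (PAlg p)ˣ where
  val := pK p
  inv := pK p * pC p
  val_inv := by rw [← mul_assoc, pK_mul_pK_mul_pC]
  inv_val := by rw [mul_assoc, pC_mul_pK, ← mul_assoc, pK_mul_pK_mul_pC]

lemma pKUnit_zpow_neg_two : ((pKUnit p ^ (-2 : ℤ) : (PAlg p)ˣ) : PAlg p) = pC p := by
  have h : pKUnit p ^ (-2 : ℤ) = (pKUnit p * pKUnit p)⁻¹ := by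
    rw [zpow_neg, zpow_ofNat, pow_two]
  rw [h]
  exact Units.inv_eq_of_mul_eq_one_right (pK_mul_pK_mul_pC p)

lemma pK_pow_mul_pC_pow (h k : ℕ) :
    pK p ^ h * pC p ^ k = ((pKUnit p ^ ((h : ℤ) - 2 * k) : (PAlg p)ˣ) : PAlg p) := by
  rw [← pKUnit_zpow_neg_two, show pK p = (pKUnit p : PAlg p) from rfl, ← Units.val_pow_eq_pow_val,
    ← Units.val_pow_eq_pow_val, ← Units.val_mul, ← zpow_natCast, ← zpow_natCast, ← zpow_mul,
    ← zpow_add]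
  congr 2

lemma exists_pK_pow_mul_pC_pow (n : ℤ) :
    ∃ h k : ℕ, (1 ≤ k → h ≤ 1) ∧ (h : ℤ) - 2 * k = n := by
  rcases le_or_gt 0 n with hn | hn
  · exact ⟨n.toNat, 0, by omega, by omega⟩
  · exact ⟨(n % 2).toNat, (-(n / 2)).toNat, by omega, by omega⟩

lemma zpow_mul_mem_Vspan (n z : ℤ) (h : (n, z) ≠ (0, 0)) :
    ((pKUnit p ^ n : (PAlg p)ˣ) : PAlg p) *
      (if z < 0 then pA p ^ (-z).toNat else pB p ^ z.toNat) ∈ Vspan p := by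
  obtain ⟨i, k, hik, rfl⟩ := exists_pK_pow_mul_pC_pow n
  rw [← pK_pow_mul_pC_pow]
  refine Submodule.subset_span ⟨(i, k, z), ⟨hik, ?_⟩, rfl⟩
  rintro ⟨⟩
  simp at h

lemma zpow_mul_pA_pow_mem_Vspan (n : ℤ) (l : ℕ) (h : (n, l) ≠ (0, 0)) :
    ((pKUnit p ^ n : (PAlg p)ˣ) : PAlg p) * pA p ^ l ∈ Vspan p := by
  have := zpow_mul_mem_Vspan p n (-l) (by simpa using h)
  rcases Nat.eq_zero_or_pos l with rfl | hl
  · simpa using this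
  · simpa [hl] using this

lemma zpow_mul_pB_pow_mem_Vspan (n : ℤ) (l : ℕ) (h : (n, l) ≠ (0, 0)) :
    ((pKUnit p ^ n : (PAlg p)ˣ) : PAlg p) * pB p ^ l ∈ Vspan p := by
  have := zpow_mul_mem_Vspan p n l (by simpa using h)
  rwa [if_neg (Int.natCast_nonneg l).not_gt, Int.toNat_natCast] at this

lemma subalgebra_eq_top_of_generators_mem (S : Subalgebra ℂ (PAlg p))
    (hK : ∀ m : ℤ, ((pKUnit p ^ m : (PAlg p)ˣ) : PAlg p) ∈ S) (hA : pA p ∈ S) (hB : pB p ∈ S) :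
    S = ⊤ := by
  have hgen (g : PGen) : RingQuot.mkAlgHom ℂ (PRel p) (FreeAlgebra.ι ℂ g) ∈ S := by
    cases g with
    | K =>
      have h := hK 1
      rwa [zpow_one] at h
    | A => exact hA
    | B => exact hB
    | C =>
      have h := hK (-2)
      rwa [pKUnit_zpow_neg_two] at h
  refine Algebra.eq_top_iff.2 fun x => ?_
  obtain ⟨f, rfl⟩ := RingQuot.mkAlgHom_surjective ℂ (PRel p) x
  induction f using FreeAlgebra.induction with
  | grade0 r =>
    rw [AlgHom.commutes]
    exact S.algebraMap_mem r
  | grade1 g => exact hgen g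
  | mul f g hf hg =>
    rw [map_mul]
    exact S.mul_mem hf hg
  | add f g hf hg =>
    rw [map_add]
    exact S.add_mem hf hg

/-- `Vspan p` contains all commutators of `PAlg p`. -/
lemma commutator_mem_Vspan {p : ℂ} (hp : p ≠ 0) (hp2 : 1 - p ^ 2 ≠ 0) (x y : PAlg p) :
    x * y - y * x ∈ Vspan p := by
  refine commutator_mem (κ := pKUnit p) (a := p⁻¹) (α := (1 - p ^ 2)⁻¹)
    (β := -((1 - p ^ 2)⁻¹ * p ^ 2)) (A := pA p) (B := pB p) (inv_ne_zero hp) ?_ ?_ ?_ ?_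
    (subalgebra_eq_top_of_generators_mem p) (zpow_mul_pA_pow_mem_Vspan p)
    (zpow_mul_pB_pow_mem_Vspan p) x y
  · exact (eq_inv_smul_iff₀ hp).2 (pA_mul_pK p)
  · rw [inv_inv]
    exact pB_mul_pK p
  · rw [pKUnit_zpow_neg_two, (eq_inv_smul_iff₀ hp2).2 (pA_mul_pB p), smul_sub, smul_smul,
      sub_eq_add_neg]
    exact congrArg _ (neg_smul _ _).symm
  · have h : -((1 - p ^ 2)⁻¹ * p ^ 2) * p⁻¹ ^ 2 = -(1 - p ^ 2)⁻¹ := by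
      field_simp
    rw [pKUnit_zpow_neg_two, (eq_inv_smul_iff₀ hp2).2 (pB_mul_pA p), smul_sub, h,
      sub_eq_add_neg]
    exact congrArg _ (neg_smul _ _).symm

end Presentation

/-- If `U` and `W` are any two basis elements of `P` neither of which
is `1`, then the commutator `[U, W] = UW - WU` lies in `V`, the span of all basis
elements other than `1`; hence `V` is a Lie subalgebra of `P`. -/
theorem statement_15 (ω : ℝ) (hω : 0 < ω) (t s : ℕ × ℕ × ℤ)
    (ht : 1 ≤ t.2.1 → t.1 ≤ 1) (htne : t ≠ (0, 0, 0))
    (hs : 1 ≤ s.2.1 → s.1 ≤ 1) (hsne : s ≠ (0, 0, 0)) :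
    pBasisElt (Real.exp (-ω) : ℂ) t * pBasisElt (Real.exp (-ω) : ℂ) s -
      pBasisElt (Real.exp (-ω) : ℂ) s * pBasisElt (Real.exp (-ω) : ℂ) t ∈
      Vspan (Real.exp (-ω) : ℂ) := by
  refine commutator_mem_Vspan (by exact_mod_cast Real.exp_ne_zero _) ?_ _ _
  have h : Real.exp (-ω) ^ 2 < 1 :=
    pow_lt_one₀ (Real.exp_pos _).le (Real.exp_lt_one_iff.2 (neg_lt_zero.2 hω)) two_ne_zero
  exact_mod_cast (sub_pos.2 h).ne'
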